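/- arXiv:2310.02607 — 4 statements merged into one kernel-verified Lean document; each statement's English description precedes it below -/
import Mathlib

section
/- For every integer m with 1 ≤ m ≤ n_γ, the residual polynomial p_m is positive, decreasing, and convex on the interval [0, x_{1,m}), where x_{1,m} is its smallest root. -/
open scoped RealInnerProductSpace BigOperators Classical
open Polynomial

noncomputable section

/-- The semi-inner product `[p,q]_(l)` associated with the measure
`μ_n^(l) = ∑ i, ξ i ^ l * w i * δ_{ξ i}`, where `w i = ⟪e i, r⟫² `. -/
def cgIP {ι : Type*} [Fintype ι] (ξ w : ι → ℝ) (l : ℕ) (p q : Polynomial ℝ) : ℝ :=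
  ∑ i, (ξ i) ^ l * w i * p.eval (ξ i) * q.eval (ξ i)

/-- The cardinality `n_γ` of the support of the measure `μ_n^(0)`. -/
def cgNGamma {ι : Type*} [Fintype ι] (ξ w : ι → ℝ) : ℕ :=
  ((Finset.univ.filter (fun i => w i ≠ 0)).image ξ).card

/-- Normal equations of the least-squares problem: a minimizer `p` among polynomials of degree at
most `m` with fixed value at `0` is orthogonal in `[·,·]_(1)` to polynomials of degree `< m`. -/
theorem cgIP_one_eq_zero_of_minimal {ι : Type*} [Fintype ι] {ξ w : ι → ℝ} {m : ℕ} {p : ℝ[X]}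
    (hdeg : p.natDegree ≤ m) (hconst : p.eval 0 = 1)
    (hmin : ∀ q : ℝ[X], q.natDegree ≤ m → q.eval 0 = 1 → cgIP ξ w 0 p p ≤ cgIP ξ w 0 q q)
    {q : ℝ[X]} (hq : q.natDegree + 1 ≤ m) : cgIP ξ w 1 p q = 0 := by
  have key : ∀ s : ℝ, 0 ≤ cgIP ξ w 2 q q * (s * s) + (2 * cgIP ξ w 1 p q) * s + 0 := by
    intro s
    have hdeg' : (p + C s * (X * q)).natDegree ≤ m :=
      natDegree_add_le_of_degree_le hdeg <|
        (natDegree_C_mul_le _ _).trans <| natDegree_mul_le.trans <| by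
          rw [natDegree_X]; omega
    have h := hmin (p + C s * (X * q)) hdeg' (by simp [hconst])
    have expand : cgIP ξ w 0 (p + C s * (X * q)) (p + C s * (X * q)) =
        cgIP ξ w 0 p p + (cgIP ξ w 2 q q * (s * s) + (2 * cgIP ξ w 1 p q) * s + 0) := by
      simp only [cgIP, Finset.mul_sum, Finset.sum_mul, ← Finset.sum_add_distrib, add_zero]
      refine Finset.sum_congr rfl fun i _ => ?_
      simp only [eval_add, eval_mul, eval_C, eval_X]
      ring
    linarith
  have hd := discrim_le_zero key
  rw [discrim] at hd
  nlinarith [sq_nonneg (cgIP ξ w 1 p q)]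

/-- The values of a continuous nowhere vanishing real function have constant sign. -/
theorem Continuous.mul_pos_of_ne_zero {f : ℝ → ℝ} (hf : Continuous f) (h0 : ∀ x, f x ≠ 0)
    (x y : ℝ) : 0 < f x * f y := by
  by_contra! hle
  have hmem : (0 : ℝ) ∈ Set.uIcc (f x) (f y) := by
    rw [Set.mem_uIcc]
    rcases mul_nonpos_iff.1 hle with h | h
    · exact Or.inr ⟨h.2, h.1⟩
    · exact Or.inl h
  obtain ⟨z, -, hz⟩ := intermediate_value_uIcc hf.continuousOn hmem
  exact h0 z hz

/-- Residual polynomials have only real roots. -/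
theorem splits_of_cgIP_minimal {ι : Type*} [Fintype ι] {ξ w : ι → ℝ}
    (hξ : ∀ i, 0 ≤ ξ i) (hw : ∀ i, 0 ≤ w i) {m : ℕ} (hmγ : m ≤ cgNGamma ξ w) {p : ℝ[X]}
    (hdeg : p.natDegree ≤ m) (hconst : p.eval 0 = 1)
    (hmin : ∀ q : ℝ[X], q.natDegree ≤ m → q.eval 0 = 1 → cgIP ξ w 0 p p ≤ cgIP ξ w 0 q q) :
    p.Splits := by
  have hp0 : p ≠ 0 := by
    rintro rfl
    simp at hconst
  refine splits_iff_splits.2 (Or.inr ?_)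
  rintro h hirr ⟨g, rfl⟩
  by_contra hne
  have hroot : ∀ x, h.eval x ≠ 0 := fun x hx =>
    hne (degree_eq_one_of_irreducible_of_root hirr hx)
  have hh0 : h ≠ 0 := left_ne_zero_of_mul hp0
  have hg0 : g ≠ 0 := right_ne_zero_of_mul hp0
  have hpos := hirr.natDegree_pos
  have hh1 : h.natDegree ≠ 1 := fun h1 => hne ((degree_eq_iff_natDegree_eq hh0).2 h1)
  rw [natDegree_mul hh0 hg0] at hdeg
  have horth := cgIP_one_eq_zero_of_minimal (by rwa [natDegree_mul hh0 hg0]) hconst hmin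
    (q := g) (by omega)
  have hsign : ∀ i, 0 < h.eval 0 * h.eval (ξ i) := fun i =>
    h.continuous.mul_pos_of_ne_zero hroot 0 (ξ i)
  have hsum : ∑ i, ξ i * w i * (h.eval 0 * h.eval (ξ i)) * g.eval (ξ i) ^ 2 = 0 := by
    refine Eq.trans ?_ ((congrArg (h.eval 0 * ·) horth).trans (mul_zero _))
    simp only [cgIP, Finset.mul_sum]
    refine Finset.sum_congr rfl fun i _ => ?_
    rw [eval_mul]
    ring
  have hterm := (Finset.sum_eq_zero_iff_of_nonneg fun i _ =>
    mul_nonneg (mul_nonneg (mul_nonneg (hξ i) (hw i)) (hsign i).le) (sq_nonneg _)).1 hsum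
  refine hg0 (eq_zero_of_natDegree_lt_card_of_eval_eq_zero' g
    (((Finset.univ.filter fun i => w i ≠ 0).image ξ).erase 0) ?_ ?_)
  · intro x hx
    obtain ⟨hx0, hx⟩ := Finset.mem_erase.1 hx
    obtain ⟨i, hi, rfl⟩ := Finset.mem_image.1 hx
    have hwi := (Finset.mem_filter.1 hi).2
    have := hterm i (Finset.mem_univ i)
    simpa [hx0, hwi, hroot] using this
  · have := Finset.pred_card_le_card_erase (s := (Finset.univ.filter fun i => w i ≠ 0).image ξ)
      (a := (0 : ℝ))
    rw [cgNGamma] at hmγ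
    omega

/-- A product of affine functions `x ↦ (x - a) / (0 - a)` with `b ≤ a` is positive, decreasing and
convex on `[0, b)`. -/
theorem prod_affine_pos_antitoneOn_convexOn {b : ℝ} (s : Multiset ℝ) (hs : ∀ a ∈ s, b ≤ a) :
    (∀ x ∈ Set.Ico 0 b, 0 < (s.map fun a => (x - a) / (0 - a)).prod) ∧
    AntitoneOn (fun x => (s.map fun a => (x - a) / (0 - a)).prod) (Set.Ico 0 b) ∧
    ConvexOn ℝ (Set.Ico 0 b) (fun x => (s.map fun a => (x - a) / (0 - a)).prod) := by
  induction s using Multiset.induction_on with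
  | empty => simp [antitoneOn_const, convexOn_const, convex_Ico]
  | cons a s ih =>
    obtain ⟨hpos, hanti, hconv⟩ := ih fun c hc => hs c (Multiset.mem_cons_of_mem hc)
    have hba : b ≤ a := hs a (Multiset.mem_cons_self a s)
    have hpos' : ∀ x ∈ Set.Ico 0 b, 0 < (x - a) / (0 - a) := fun x hx =>
      div_pos_of_neg_of_neg (by linarith [hx.2]) (by linarith [hx.1, hx.2])
    have hanti' : AntitoneOn (fun x => (x - a) / (0 - a)) (Set.Ico 0 b) := fun x hx y _ hxy =>
      div_le_div_of_nonpos_of_le (by linarith [hx.1, hx.2]) (by linarith)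
    have hconv' : ConvexOn ℝ (Set.Ico 0 b) (fun x => (x - a) / (0 - a)) :=
      ⟨convex_Ico 0 b, fun x _ y _ u v _ _ huv => le_of_eq <| by
        simp only [smul_eq_mul]
        linear_combination (a / (0 - a)) * huv⟩
    simp only [Multiset.map_cons, Multiset.prod_cons]
    exact ⟨fun x hx => mul_pos (hpos' x hx) (hpos x hx),
      fun x hx y hy hxy => mul_le_mul (hanti' hx hy hxy) (hanti hx hy hxy) (hpos y hy).le
        (hpos' x hx).le,
      hconv'.mul hconv (fun x hx => (hpos' x hx).le) (fun x hx => (hpos x hx).le)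
        (hanti'.monovaryOn hanti)⟩

/-- for `1 ≤ m ≤ n_γ`, the residual polynomial `p_m` is positive,
decreasing and convex on `[0, x_{1,m})`, where `x_{1,m}` is its smallest root. -/
theorem residual_polynomial_positive_decreasing_convex
    {E : Type*} [NormedAddCommGroup E] [InnerProductSpace ℝ E] [CompleteSpace E]
    {ι : Type*} [Fintype ι]
    (Λn : E →L[ℝ] E) (hsa : IsSelfAdjoint Λn) (hpos : ∀ x, 0 ≤ ⟪Λn x, x⟫)
    (κ : ℝ) (hκ : 0 < κ)
    (e : ι → E) (he : Orthonormal ℝ e) (ξ : ι → ℝ)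
    (hev : ∀ i, Λn (e i) = ξ i • e i) (hξ : ∀ i, ξ i ∈ Set.Icc 0 κ)
    (r : E) (w : ι → ℝ) (hw : ∀ i, w i = ⟪e i, r⟫ ^ 2)
    (m : ℕ) (hm : 1 ≤ m) (hmγ : m ≤ cgNGamma ξ w)
    -- `p` is the residual polynomial `p_m`
    (p : Polynomial ℝ) (hdeg : p.natDegree ≤ m) (hconst : p.eval 0 = 1)
    (hmin : ∀ q : Polynomial ℝ, q.natDegree ≤ m → q.eval 0 = 1 →
      cgIP ξ w 0 p p ≤ cgIP ξ w 0 q q)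
    -- `x1` is the smallest root `x_{1,m}` of `p_m`
    (x1 : ℝ) (hx1 : IsLeast {x : ℝ | p.eval x = 0} x1) :
    (∀ x ∈ Set.Ico 0 x1, 0 < p.eval x) ∧
    AntitoneOn (fun x => p.eval x) (Set.Ico 0 x1) ∧
    ConvexOn ℝ (Set.Ico 0 x1) (fun x => p.eval x) := by
  have hsplit : p.Splits := splits_of_cgIP_minimal (fun i => (hξ i).1)
    (fun i => hw i ▸ sq_nonneg _) hmγ hdeg hconst hmin
  have hp0 : p ≠ 0 := by
    rintro rfl
    simp at hconst
  have heval : ∀ x, p.eval x = (p.roots.map fun a => (x - a) / (0 - a)).prod := fun x => by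
    have hlead := leadingCoeff_ne_zero.2 hp0
    rw [Multiset.prod_map_div, ← div_one (p.eval x), ← hconst, hsplit.eval_eq_prod_roots x,
      hsplit.eval_eq_prod_roots 0, mul_div_mul_left _ _ hlead]
  simp only [heval]
  exact prod_affine_pos_antitoneOn_convexOn p.roots fun a ha => hx1.2 (mem_roots'.1 ha).2
end
end

section
/- Under the eigenvalue decay condition (for some s ∈ (0,1), the eigenvalues ξ_i of Λ satisfy b i^{-1/s} ≤ ξ_i ≤ B i^{-1/s} for constants b, B > 0), there exists a constant D > 0 such that the effective dimension N(λ) = trace(Λ(Λ + λI)^{-1}) satisfies N(λ) ≤ D² (κλ)^{-s} for all λ ∈ (0, 1], where κ is an upper bound on the spectrum of Λ. -/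
open scoped RealInnerProductSpace BigOperators Classical
open Polynomial

noncomputable section

/-- A telescoping bound for the general term of a `p`-series with `p = q + 1`. -/
lemma mul_rpow_neg_add_one_le_sub {q x : ℝ} (hq : 0 ≤ q) (hx : 0 < x) :
    q * (x + 1) ^ (-(q + 1)) ≤ x ^ (-q) - (x + 1) ^ (-q) := by
  have hx1 : 0 < x + 1 := by linarith
  have hr : 0 < x / (x + 1) := div_pos hx hx1
  have hlog : Real.log (x / (x + 1)) ≤ -(1 / (x + 1)) := by
    refine (Real.log_le_sub_one_of_pos hr).trans_eq ?_
    field_simp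
    ring
  have hbern : 1 + q * (1 / (x + 1)) ≤ (x / (x + 1)) ^ (-q) := by
    rw [Real.rpow_def_of_pos hr]
    have := Real.add_one_le_exp (Real.log (x / (x + 1)) * -q)
    nlinarith [mul_le_mul_of_nonneg_left hlog hq]
  have hpow : (x + 1) ^ (-(q + 1)) = (x + 1) ^ (-q) * (1 / (x + 1)) := by
    rw [neg_add, Real.rpow_add hx1, Real.rpow_neg_one, one_div]
  have hsplit : x ^ (-q) = (x + 1) ^ (-q) * (x / (x + 1)) ^ (-q) := by
    rw [← Real.mul_rpow hx1.le hr.le, mul_div_cancel₀ _ hx1.ne']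
  rw [hpow, hsplit]
  nlinarith [mul_le_mul_of_nonneg_left hbern (Real.rpow_pos_of_pos hx1 (-q)).le]

/-- If the terms of a sequence are at most `1` and at most `A (i + 1) ^ (-(q + 1))`, its partial sums
are bounded by splitting at any `N ≥ 1`. -/
lemma sum_range_le_of_le_one_of_le_rpow {f : ℕ → ℝ} {A q : ℝ} (hA : 0 ≤ A) (hq : 0 < q)
    (hf0 : ∀ i, 0 ≤ f i) (hf1 : ∀ i, f i ≤ 1)
    (hf : ∀ i : ℕ, f i ≤ A * ((i : ℝ) + 1) ^ (-(q + 1))) {N : ℕ} (hN : 1 ≤ N) (n : ℕ) :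
    ∑ i ∈ Finset.range n, f i ≤ N + A / q * (N : ℝ) ^ (-q) := by
  have hAq : 0 ≤ A / q := div_nonneg hA hq.le
  have key : ∀ m, N ≤ m → ∑ i ∈ Finset.range m, f i ≤
      N + A / q * ((N : ℝ) ^ (-q) - (m : ℝ) ^ (-q)) := by
    intro m hm
    induction m, hm using Nat.le_induction with
    | base =>
      simpa using Finset.sum_le_card_nsmul (Finset.range N) f 1 fun i _ => hf1 i
    | succ m hm ih =>
      have hm0 : (0 : ℝ) < m := by exact_mod_cast hN.trans hm
      have hstep := mul_le_mul_of_nonneg_left (mul_rpow_neg_add_one_le_sub hq.le hm0) hAq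
      rw [← mul_assoc, div_mul_cancel₀ _ hq.ne'] at hstep
      rw [Finset.sum_range_succ]
      push_cast
      linarith [hf m]
  calc ∑ i ∈ Finset.range n, f i ≤ ∑ i ∈ Finset.range (max n N), f i :=
        Finset.sum_le_sum_of_subset_of_nonneg
          (Finset.range_subset_range.2 (le_max_left n N)) fun i _ _ => hf0 i
    _ ≤ N + A / q * ((N : ℝ) ^ (-q) - ((max n N : ℕ) : ℝ) ^ (-q)) := key _ (le_max_right n N)
    _ ≤ N + A / q * (N : ℝ) ^ (-q) := by
        gcongr
        exact sub_le_self _ (Real.rpow_nonneg (Nat.cast_nonneg _) _)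

/-- under the polynomial eigenvalue decay condition
`b i^{-1/s} ≤ ξ_i ≤ B i^{-1/s}` (for some `s ∈ (0,1)`), there exists `D > 0` with
`N(λ) = trace(Λ(Λ + λI)^{-1}) = ∑ i, ξ_i/(ξ_i + λ) ≤ D² (κλ)^{-s}` for all
`λ ∈ (0,1]`, where `κ` bounds the spectrum of `Λ`.

The eigenvalues are indexed by `i ∈ ℕ` starting at `i = 1` (i.e. `ξ i` is the
`(i+1)`-st eigenvalue), and the trace of `Λ(Λ + λI)^{-1}` is expressed through the
eigenvalue–eigenbasis decomposition of the positive self-adjoint trace-class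
operator `Λ`. -/
theorem effective_dimension_bound
    {E : Type*} [NormedAddCommGroup E] [InnerProductSpace ℝ E] [CompleteSpace E]
    (Λ : E →L[ℝ] E) (hsa : IsSelfAdjoint Λ)
    (κ : ℝ) (hκ : 0 < κ)
    -- eigenbasis of `Λ` with eigenvalues `ξ`
    (e : HilbertBasis ℕ ℝ E) (ξ : ℕ → ℝ)
    (hev : ∀ i, Λ (e i) = ξ i • e i)
    (hξpos : ∀ i, 0 < ξ i) (hξκ : ∀ i, ξ i ≤ κ)
    (htrace : Summable ξ)
    -- decay condition
    (s b B : ℝ) (hs0 : 0 < s) (hs1 : s < 1) (hb : 0 < b) (hB : 0 < B)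
    (hlow : ∀ i : ℕ, b * ((i : ℝ) + 1) ^ (-(1 / s)) ≤ ξ i)
    (hupp : ∀ i : ℕ, ξ i ≤ B * ((i : ℝ) + 1) ^ (-(1 / s))) :
    ∃ D : ℝ, 0 < D ∧ ∀ lam : ℝ, 0 < lam → lam ≤ 1 →
      (∑' i : ℕ, ξ i / (ξ i + lam)) ≤ D ^ 2 * (κ * lam) ^ (-s) := by
  have hq : 0 < 1 / s - 1 := by
    rw [sub_pos, lt_div_iff₀ hs0]
    linarith
  set q : ℝ := 1 / s - 1 with hqdef
  have hC : 0 < (2 + B / q) * κ ^ s := by positivity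
  refine ⟨√((2 + B / q) * κ ^ s), Real.sqrt_pos.2 hC, fun lam hlam hlam1 => ?_⟩
  rw [Real.sq_sqrt hC.le, Real.mul_rpow hκ.le hlam.le, Real.rpow_neg hκ.le]
  have hκs : κ ^ s ≠ 0 := (Real.rpow_pos_of_pos hκ s).ne'
  have hrhs : (2 + B / q) * κ ^ s * ((κ ^ s)⁻¹ * lam ^ (-s)) = (2 + B / q) * lam ^ (-s) := by
    field_simp
  rw [hrhs]
  have hM : 1 ≤ lam ^ (-s) := Real.one_le_rpow_of_pos_of_le_one_of_nonpos hlam hlam1 (by linarith)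
  have hN : 1 ≤ ⌈lam ^ (-s)⌉₊ := Nat.one_le_ceil_iff.2 (by linarith)
  have hNle : (⌈lam ^ (-s)⌉₊ : ℝ) ≤ 2 * lam ^ (-s) := by
    linarith [Nat.ceil_lt_add_one (by linarith : 0 ≤ lam ^ (-s))]
  have hNq : (⌈lam ^ (-s)⌉₊ : ℝ) ^ (-q) ≤ lam ^ (-s) * lam := by
    calc (⌈lam ^ (-s)⌉₊ : ℝ) ^ (-q) ≤ (lam ^ (-s)) ^ (-q) :=
          Real.rpow_le_rpow_of_nonpos (by linarith) (Nat.le_ceil _) (by linarith)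
      _ = lam ^ (-s + 1) := by
          rw [← Real.rpow_mul hlam.le, hqdef]
          congr 1
          field_simp
          ring
      _ = lam ^ (-s) * lam := by rw [Real.rpow_add hlam, Real.rpow_one]
  have hden : ∀ i, 0 < ξ i + lam := fun i => add_pos (hξpos i) hlam
  have hnonneg : ∀ i, 0 ≤ ξ i / (ξ i + lam) := fun i => div_nonneg (hξpos i).le (hden i).le
  have hle : ∀ i : ℕ, ξ i / (ξ i + lam) ≤ B / lam * ((i : ℝ) + 1) ^ (-(q + 1)) := by
    intro i
    calc ξ i / (ξ i + lam) ≤ ξ i / lam :=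
          div_le_div_of_nonneg_left (hξpos i).le hlam (by linarith [hξpos i])
      _ ≤ B * ((i : ℝ) + 1) ^ (-(1 / s)) / lam := div_le_div_of_nonneg_right (hupp i) hlam.le
      _ = B / lam * ((i : ℝ) + 1) ^ (-(q + 1)) := by
          rw [hqdef, sub_add_cancel, mul_div_right_comm]
  refine Real.tsum_le_of_sum_range_le hnonneg fun n => ?_
  calc ∑ i ∈ Finset.range n, ξ i / (ξ i + lam)
      ≤ ⌈lam ^ (-s)⌉₊ + B / lam / q * (⌈lam ^ (-s)⌉₊ : ℝ) ^ (-q) :=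
        sum_range_le_of_le_one_of_le_rpow (div_pos hB hlam).le hq hnonneg
          (fun i => (div_le_one (hden i)).2 (by linarith)) hle hN n
    _ ≤ 2 * lam ^ (-s) + B / lam / q * (lam ^ (-s) * lam) := by gcongr
    _ = (2 + B / q) * lam ^ (-s) := by field_simp
end
end

section
/- Let A and B be positive self-adjoint bounded operators on a Hilbert space and λ > 0. If ‖(A − B)(B + λI)^{-1}‖_op ≤ 1/2, then ‖(B + λI)(A + λI)^{-1}‖_op ≤ 2, and moreover, by Cordes' inequality, ‖(B + λI)^ν (A + λI)^{-ν}‖_op ≤ 2^ν for every ν ∈ [0,1]. -/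
open scoped BigOperators
open ContinuousLinearMap

noncomputable section

section CStarAlgebra

variable {R : Type*} [CStarAlgebra R] [PartialOrder R] [StarOrderedRing R]

/-- Real powers are homogeneous on strictly positive elements. -/
lemma rpow_smul_of_isStrictlyPositive {a : R} (ha : IsStrictlyPositive a) {c : ℝ} (hc : 0 < c)
    (p : ℝ) : (c • a) ^ p = c ^ p • a ^ p := by
  have hspec : ∀ x ∈ spectrum ℝ a, 0 < x := fun x hx => ha.spectrum_pos hx
  have hcont : ContinuousOn (fun x : ℝ => x ^ p) (spectrum ℝ a) :=
    ContinuousOn.rpow_const continuousOn_id fun x hx => Or.inl (hspec x hx).ne'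
  have hsa : IsSelfAdjoint a := .of_nonneg ha.nonneg
  have hca : c • a = cfc (fun x : ℝ => c * x) a := (cfc_const_mul_id c a).symm
  rw [hca, CFC.cfc_rpow (fun x hx => mul_pos hc (hspec x hx)),
    CFC.rpow_eq_cfc_real ha.nonneg, ← cfc_smul (c ^ p) _ a hcont]
  exact cfc_congr fun x hx => Real.mul_rpow hc.le (hspec x hx).le

/-- Cordes' inequality, normalised to the bound `1`. -/
lemma norm_rpow_mul_rpow_neg_le_one {a b : R} (ha : 0 ≤ a) (hb : IsStrictlyPositive b)
    (h : ‖a * b ^ (-1 : ℝ)‖ ≤ 1) {p : ℝ} (hp : p ∈ Set.Icc (0 : ℝ) 1) :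
    ‖a ^ p * b ^ (-p)‖ ≤ 1 := by
  have key : ∀ q : ℝ, 0 ≤ q →
      ((a ^ (2 : ℝ)) ^ q ≤ (b ^ (2 : ℝ)) ^ q ↔ ‖a ^ q * b ^ (-q)‖ ≤ 1) := by
    intro q hq
    have hb' : IsStrictlyPositive ((b ^ (2 : ℝ)) ^ q) := (hb.rpow b 2).rpow _ q
    rw [le_iff_norm_sqrt_mul_rpow _ _ CFC.rpow_nonneg hb', CFC.sqrt_eq_rpow,
      CFC.rpow_rpow_of_exponent_nonneg a 2 q zero_le_two hq,
      CFC.rpow_rpow_of_exponent_nonneg a _ _ (by positivity) (by norm_num),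
      CFC.rpow_rpow b 2 q two_ne_zero]
    rcases hq.eq_or_lt with rfl | hq
    · simp [CFC.rpow_zero b hb.nonneg]
    · rw [CFC.rpow_rpow b _ _ (by positivity)]
      ring_nf
  rw [← key p hp.1]
  refine CFC.rpow_le_rpow hp ?_
  have h1 := (key 1 zero_le_one).2 (by rwa [CFC.rpow_one a])
  rwa [CFC.rpow_one _ CFC.rpow_nonneg, CFC.rpow_one _ CFC.rpow_nonneg] at h1

/-- **Cordes' inequality** for a nonnegative element and the inverse of a strictly positive one. -/
lemma norm_rpow_mul_rpow_neg_le {a b : R} (ha : 0 ≤ a) (hb : IsStrictlyPositive b) {c : ℝ}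
    (hc : 0 < c) (h : ‖a * b ^ (-1 : ℝ)‖ ≤ c) {p : ℝ} (hp : p ∈ Set.Icc (0 : ℝ) 1) :
    ‖a ^ p * b ^ (-p)‖ ≤ c ^ p := by
  have scale : ∀ q : ℝ, ‖a ^ q * (c • b) ^ (-q)‖ = (c ^ q)⁻¹ * ‖a ^ q * b ^ (-q)‖ := by
    intro q
    rw [rpow_smul_of_isStrictlyPositive hb hc, mul_smul_comm, norm_smul,
      Real.norm_of_nonneg (by positivity), Real.rpow_neg hc.le]
  have hcb : IsStrictlyPositive (c • b) := hb.smul hc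
  have h1 : ‖a * (c • b) ^ (-1 : ℝ)‖ ≤ 1 := by
    have := scale 1
    rw [CFC.rpow_one a, Real.rpow_one] at this
    rw [this]
    exact inv_mul_le_one_of_le₀ h hc.le
  have h2 := norm_rpow_mul_rpow_neg_le_one ha hcb h1 hp
  rwa [scale, inv_mul_le_iff₀ (by positivity), mul_one] at h2

/-- A shifted real power, as given by the continuous functional calculus, is the real power of the
shifted element. -/
lemma cfc_add_const_rpow {a : R} (ha : 0 ≤ a) {r : ℝ} (hr : 0 < r) (p : ℝ) :
    cfc (fun x : ℝ => (x + r) ^ p) a = (a + algebraMap ℝ R r) ^ p := by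
  have hsa : IsSelfAdjoint a := .of_nonneg ha
  have hadd : a + algebraMap ℝ R r = cfc (fun x : ℝ => x + r) a := by
    rw [cfc_add_const r (fun x => x) a, cfc_id' ℝ a]
  rw [hadd, CFC.cfc_rpow fun x hx => add_pos_of_nonneg_of_pos (spectrum_nonneg_of_nonneg ha hx) hr]

end CStarAlgebra

/-- If `u` is a left inverse of `s`, `v` a right inverse of `t`, and `t` is close to `s` in that
`‖(t - s) u‖ ≤ 1 / 2`, then `‖s v‖ ≤ 2`. -/
lemma norm_mul_le_two_of_norm_sub_mul_le_half {R : Type*} [NormedRing R] (hone : ‖(1 : R)‖ ≤ 1)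
    {s u t v : R} (hs : u * s = 1) (ht : t * v = 1) (h : ‖(t - s) * u‖ ≤ 1 / 2) :
    ‖s * v‖ ≤ 2 := by
  have hX : s * v = 1 - (t - s) * u * (s * v) := by
    rw [mul_assoc, ← mul_assoc u, hs, one_mul, sub_mul, ht, sub_sub_cancel]
  have h1 : ‖s * v‖ ≤ ‖(1 : R)‖ + ‖(t - s) * u‖ * ‖s * v‖ := by
    conv_lhs => rw [hX]
    exact (norm_sub_le _ _).trans (by gcongr; exact norm_mul_le _ _)
  nlinarith [norm_nonneg (s * v)]

/-- let `A, B` be positive (self-adjoint) bounded operators on a Hilbert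
space and `λ > 0`. If `‖(A − B)(B + λI)^{-1}‖ ≤ 1/2`, then
`‖(B + λI)(A + λI)^{-1}‖ ≤ 2`, and by Cordes' inequality
`‖(B + λI)^ν (A + λI)^{-ν}‖ ≤ 2^ν` for every `ν ∈ [0,1]`; the real powers are given by
the continuous functional calculus. -/
theorem operator_inverse_and_cordes_bound
    {E : Type*} [NormedAddCommGroup E] [InnerProductSpace ℂ E] [CompleteSpace E]
    (A B : E →L[ℂ] E) (hA : A.IsPositive) (hB : B.IsPositive)
    (lam : ℝ) (hlam : 0 < lam)
    -- `RB = (B + λI)^{-1}` and `RA = (A + λI)^{-1}`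
    (RB : E →L[ℂ] E) (hRB₁ : (B + (lam : ℂ) • (1 : E →L[ℂ] E)) ∘L RB = 1)
    (hRB₂ : RB ∘L (B + (lam : ℂ) • (1 : E →L[ℂ] E)) = 1)
    (RA : E →L[ℂ] E) (hRA₁ : (A + (lam : ℂ) • (1 : E →L[ℂ] E)) ∘L RA = 1)
    (hRA₂ : RA ∘L (A + (lam : ℂ) • (1 : E →L[ℂ] E)) = 1)
    (hsmall : ‖(A - B) ∘L RB‖ ≤ 1 / 2) :
    ‖(B + (lam : ℂ) • (1 : E →L[ℂ] E)) ∘L RA‖ ≤ 2 ∧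
    ∀ ν : ℝ, ν ∈ Set.Icc (0 : ℝ) 1 →
      ‖(cfc (fun x : ℝ => (x + lam) ^ ν) B) ∘L (cfc (fun x : ℝ => (x + lam) ^ (-ν)) A)‖ ≤
        2 ^ ν := by
  have hadd : ∀ T : E →L[ℂ] E, T + (lam : ℂ) • (1 : E →L[ℂ] E) = T + algebraMap ℝ _ lam := by
    intro T
    rw [Algebra.algebraMap_eq_smul_one, Complex.coe_smul]
  have hbound : ‖(B + (lam : ℂ) • (1 : E →L[ℂ] E)) ∘L RA‖ ≤ 2 :=
    norm_mul_le_two_of_norm_sub_mul_le_half ContinuousLinearMap.norm_id_le hRB₂ hRA₁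
      (by rw [add_sub_add_right_eq_sub]; exact hsmall)
  refine ⟨hbound, fun ν hν => ?_⟩
  have hA0 : 0 ≤ A := (ContinuousLinearMap.nonneg_iff_isPositive A).2 hA
  have hB0 : 0 ≤ B := (ContinuousLinearMap.nonneg_iff_isPositive B).2 hB
  have hlam0 : (0 : E →L[ℂ] E) ≤ algebraMap ℝ _ lam := algebraMap_nonneg _ hlam.le
  rw [hadd] at hRA₁ hRA₂ hbound
  have hS : 0 ≤ B + algebraMap ℝ (E →L[ℂ] E) lam := add_nonneg hB0 hlam0
  have hT : IsStrictlyPositive (A + algebraMap ℝ (E →L[ℂ] E) lam) :=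
    ⟨add_nonneg hA0 hlam0, isUnit_iff_exists.2 ⟨RA, hRA₁, hRA₂⟩⟩
  have hRA : (A + algebraMap ℝ (E →L[ℂ] E) lam) ^ (-1 : ℝ) = RA :=
    left_inv_eq_right_inv (by simpa [CFC.rpow_one _ hT.nonneg] using CFC.rpow_neg_mul_rpow 1 hT)
      hRA₁
  rw [cfc_add_const_rpow hB0 hlam, cfc_add_const_rpow hA0 hlam]
  exact norm_rpow_mul_rpow_neg_le hS hT two_pos (by rw [hRA]; exact hbound) hν
end
end

section
/- Let 1 ≤ m ≤ n_γ and 0 < u ≤ x_{1,m}, and suppose β* = T^{1/2}Λ^α g with α > 0, g ∈ L²(S). On the event where the functional-calculus bound ‖φ(Λ̂_n)Λ^α‖_op ≲ sup_t t^α φ(t) + max{α,1} Z_α(λ) sup_t φ(t) holds, one has ‖F_u ( q_m(Λ̂_n)T^{1/2}Ĉ_n β* − Λ^α g )‖_{L²} = ‖F_u p_m(Λ̂_n) Λ^α g‖_{L²} ≤ 2 ( u^α + max{α, 1} Z_α(λ) ) ‖g‖_{L²}, where F_u is the orthogonal projection onto the span of eigenfunctions of Λ̂_n with eigenvalue < u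 and Z_α(λ) = λ^α if α ≤ 1, Z_α(λ) = κ^α sqrt(E‖X‖⁴/(nδ)) if α > 1. -/
open scoped RealInnerProductSpace BigOperators Classical
open Polynomial MeasureTheory ProbabilityTheory ContinuousLinearMap

noncomputable section

/-- The rank-one operator `x ⊗ x : y ↦ ⟪x, y⟫ x`. -/
def rankOne {E : Type*} [NormedAddCommGroup E] [InnerProductSpace ℝ E] (x : E) :
    E →L[ℝ] E :=
  (innerSL ℝ x).smulRight x

/-- The empirical covariance operator `Ĉ_n = (1/n) ∑ X_i ⊗ X_i`. -/
def empCov {E : Type*} [NormedAddCommGroup E] [InnerProductSpace ℝ E]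
    (n : ℕ) (X : Fin n → E) : E →L[ℝ] E :=
  (n : ℝ)⁻¹ • ∑ i, rankOne (X i)

/-- The empirical vector `R̂ = (1/n) ∑ Y_i X_i`. -/
def empRhat {E : Type*} [NormedAddCommGroup E] [InnerProductSpace ℝ E]
    (n : ℕ) (X : Fin n → E) (Y : Fin n → ℝ) : E :=
  (n : ℝ)⁻¹ • ∑ i, Y i • X i

/-- `φ(Λ̂_n)` for a finite-rank operator `Λ̂_n` with orthonormal eigenfunctions `e'`,
eigenvalues `ξ'`, and vanishing on the orthogonal complement of the `e'`. -/
def phiOp {E : Type*} [NormedAddCommGroup E] [InnerProductSpace ℝ E]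
    {N : ℕ} (e' : Fin N → E) (ξ' : Fin N → ℝ) (φ : ℝ → ℝ) : E →L[ℝ] E :=
  φ 0 • ((1 : E →L[ℝ] E) - ∑ j, rankOne (e' j)) + ∑ j, φ (ξ' j) • rankOne (e' j)

/-- The orthogonal projection `F_u` onto the span of the eigenfunctions of `Λ̂_n`
with eigenvalue `< u`. -/
def FuOp {E : Type*} [NormedAddCommGroup E] [InnerProductSpace ℝ E]
    {N : ℕ} (e' : Fin N → E) (ξ' : Fin N → ℝ) (u : ℝ) : E →L[ℝ] E :=
  (1 : E →L[ℝ] E) - ∑ j ∈ Finset.univ.filter (fun j => u ≤ ξ' j), rankOne (e' j)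

lemma rankOne_apply {E : Type*} [NormedAddCommGroup E] [InnerProductSpace ℝ E] (x y : E) :
    rankOne x y = ⟪x, y⟫ • x := by
  simp [rankOne]

lemma aeval_apply_of_eigenvector {E : Type*} [NormedAddCommGroup E] [InnerProductSpace ℝ E]
    (L : E →L[ℝ] E) {μ : ℝ} {x : E} (hx : L x = μ • x) (p : ℝ[X]) :
    aeval L p x = p.eval μ • x := by
  induction p using Polynomial.induction_on' with
  | add p q hp hq => simp [hp, hq, add_smul]
  | monomial k a =>
    have hpow : (L ^ k) x = μ ^ k • x := by
      induction k with
      | zero => simp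
      | succ k ih =>
        rw [pow_succ', mul_apply_eq_comp, ih, map_smul, hx, smul_smul, pow_succ]
    simp [aeval_monomial, Algebra.algebraMap_eq_smul_one, hpow, smul_smul]

section Orthonormal

variable {E : Type*} [NormedAddCommGroup E] [InnerProductSpace ℝ E] {N : ℕ} {e' : Fin N → E}

lemma phiOp_apply (ξ' : Fin N → ℝ) (φ : ℝ → ℝ) (x : E) :
    phiOp e' ξ' φ x =
      φ 0 • (x - ∑ j, ⟪e' j, x⟫ • e' j) + ∑ j, φ (ξ' j) • ⟪e' j, x⟫ • e' j := by
  simp [phiOp, rankOne_apply, sum_apply]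

lemma Orthonormal.inner_sub_sum_eq_zero (he' : Orthonormal ℝ e') (x : E) (j : Fin N) :
    ⟪e' j, x - ∑ k, ⟪e' k, x⟫ • e' k⟫ = 0 := by
  rw [inner_sub_right, he'.inner_right_fintype, sub_self]

lemma FuOp_apply (ξ' : Fin N → ℝ) (u : ℝ) (x : E) :
    FuOp e' ξ' u x =
      x - ∑ j ∈ Finset.univ.filter (fun j => u ≤ ξ' j), ⟪e' j, x⟫ • e' j := by
  simp [FuOp, rankOne_apply, sum_apply]

lemma FuOp_apply_of_orthogonal (ξ' : Fin N → ℝ) (u : ℝ) {x : E} (hx : ∀ j, ⟪e' j, x⟫ = 0) :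
    FuOp e' ξ' u x = x := by
  simp [FuOp_apply, hx]

lemma FuOp_apply_eigenvector (he' : Orthonormal ℝ e') (ξ' : Fin N → ℝ) (u : ℝ) (j : Fin N) :
    FuOp e' ξ' u (e' j) = if ξ' j < u then e' j else 0 := by
  rw [FuOp_apply]
  simp only [orthonormal_iff_ite.mp he', ite_smul, one_smul, zero_smul, Finset.sum_ite_eq',
    Finset.mem_filter, Finset.mem_univ, true_and]
  split_ifs with h₁ h₂ h₂
  · exact absurd h₂ (not_lt.mpr h₁)
  · simp
  · simp
  · exact absurd (not_le.mp h₁) h₂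

/-- A polynomial in an operator diagonalized by `e'` is its functional calculus. -/
lemma aeval_eq_phiOp (he' : Orthonormal ℝ e') (ξ' : Fin N → ℝ) (L : E →L[ℝ] E)
    (hL : ∀ j, L (e' j) = ξ' j • e' j) (hker : ∀ x, (∀ j, ⟪e' j, x⟫ = 0) → L x = 0)
    (p : ℝ[X]) : aeval L p = phiOp e' ξ' (fun t => p.eval t) := by
  ext x
  have hy := aeval_apply_of_eigenvector L (μ := 0)
    (by rw [hker _ (he'.inner_sub_sum_eq_zero x), zero_smul]) p
  rw [phiOp_apply, ← hy, map_sub, map_sum]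
  simp_rw [map_smul, aeval_apply_of_eigenvector L (hL _) p, smul_comm (p.eval _)]
  abel

/-- Composing with the spectral projection `F_u` truncates the function to `(-∞, u)`. -/
lemma FuOp_comp_phiOp (he' : Orthonormal ℝ e') (ξ' : Fin N → ℝ) {u : ℝ} (hu : 0 < u)
    (ψ : ℝ → ℝ) :
    FuOp e' ξ' u ∘L phiOp e' ξ' ψ = phiOp e' ξ' (fun t => if t < u then ψ t else 0) := by
  ext x
  rw [comp_apply, phiOp_apply, phiOp_apply, map_add, map_smul, map_sum,
    FuOp_apply_of_orthogonal ξ' u (he'.inner_sub_sum_eq_zero x), if_pos hu]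
  congr 1
  refine Finset.sum_congr rfl fun j _ => ?_
  rw [map_smul, map_smul, FuOp_apply_eigenvector he']
  split_ifs <;> simp

end Orthonormal

/-- `φ(Λ̂)` only depends on the values of `φ` at `0` and at the eigenvalues. -/
lemma phiOp_congr {E : Type*} [NormedAddCommGroup E] [InnerProductSpace ℝ E] {N : ℕ}
    {e' : Fin N → E} {ξ' : Fin N → ℝ} {φ ψ : ℝ → ℝ} (h0 : φ 0 = ψ 0)
    (h : ∀ j, φ (ξ' j) = ψ (ξ' j)) : phiOp e' ξ' φ = phiOp e' ξ' ψ := by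
  simp only [phiOp, h0, h]

lemma Real.biSup_le {s : Set ℝ} {h : ℝ → ℝ} {a : ℝ} (ha : 0 ≤ a) (hs : ∀ t ∈ s, h t ≤ a) :
    ⨆ t ∈ s, h t ≤ a :=
  Real.iSup_le (fun t => Real.iSup_le (hs t) ha) ha

/-- estimation of Term-2. For `1 ≤ m ≤ n_γ`, `0 < u ≤ x_{1,m}` and the
source condition `β* = T^{1/2} Λ^α g`, on the event where the functional-calculus
bound holds,
`‖F_u(q_m(Λ̂_n) T^{1/2} Ĉ_n β* − Λ^α g)‖ = ‖F_u p_m(Λ̂_n) Λ^α g‖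
   ≤ 2 (u^α + max{α,1} Z_α(λ)) ‖g‖`. -/
theorem term_two_estimate
    {E : Type*} [NormedAddCommGroup E] [InnerProductSpace ℝ E] [CompleteSpace E]
    [MeasurableSpace E] [BorelSpace E]
    {Ω : Type*} [MeasureSpace Ω] [IsProbabilityMeasure (ℙ : Measure Ω)]
    (X : Ω → E) (hX : Measurable X) (hX4 : Integrable (fun ω => ‖X ω‖ ^ 4) ℙ)
    (n : ℕ) (hn : 0 < n) (δ : ℝ) (hδ : δ ∈ Set.Ioo (0 : ℝ) 1)
    -- `M4 = E‖X‖⁴`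
    (M4 : ℝ) (hM4 : M4 = ∫ ω : Ω, ‖X ω‖ ^ 4 ∂ℙ)
    -- a realization of the sample, `Ĉ_n`, `R̂` and `Λ̂_n = T^{1/2} Ĉ_n T^{1/2}`
    (Xs : Fin n → E) (Ys : Fin n → ℝ)
    (Thalf : E →L[ℝ] E) (hTsa : IsSelfAdjoint Thalf) (hTpos : ∀ x, 0 ≤ ⟪Thalf x, x⟫)
    (C : E →L[ℝ] E) (hC : ∀ f' g' : E, ⟪C f', g'⟫ = ∫ ω, ⟪X ω, f'⟫ * ⟪X ω, g'⟫ ∂ℙ)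
    (κ : ℝ) (hκ : 0 < κ)
    -- eigenbasis of `Λ = T^{1/2} C T^{1/2}`, spectrum in `[0, κ]`
    {ι : Type*} (f : HilbertBasis ι ℝ E) (η : ι → ℝ)
    (hev : ∀ i, (Thalf ∘L C ∘L Thalf) (f i) = η i • f i)
    (hη : ∀ i, η i ∈ Set.Icc 0 κ)
    -- finite eigenvalue–eigenfunction system of `Λ̂_n`
    {N : ℕ} (e' : Fin N → E) (ξ' : Fin N → ℝ) (he' : Orthonormal ℝ e')
    (hev' : ∀ j, (Thalf ∘L empCov n Xs ∘L Thalf) (e' j) = ξ' j • e' j)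
    (hker : ∀ x : E, (∀ j, ⟪e' j, x⟫ = 0) → (Thalf ∘L empCov n Xs ∘L Thalf) x = 0)
    (hξ' : ∀ j, ξ' j ∈ Set.Icc 0 κ)
    -- source condition: `β* = T^{1/2} Λ^α g`, with `Λ^α` given by the eigenbasis
    (α : ℝ) (hα : 0 < α) (g : E)
    (Λα : E →L[ℝ] E) (hΛα : ∀ i, Λα (f i) = ((η i) ^ α) • f i)
    (βstar : E) (hβ : βstar = Thalf (Λα g))
    (lam : ℝ) (hlam : 0 < lam)
    -- the functional-calculus bound (Lemma `fb`), valid on the event considered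
    (hfb : ∀ φ : ℝ → ℝ, Measurable φ → (∀ t, 0 ≤ φ t) → BddAbove (φ '' Set.Icc 0 κ) →
      ‖(phiOp e' ξ' φ) ∘L Λα‖ ≤
        2 * ((⨆ t ∈ Set.Icc (0 : ℝ) κ, t ^ α * φ t) +
          max α 1 * (if α ≤ 1 then lam ^ α
              else κ ^ α * Real.sqrt (M4 / (n * δ))) *
            (⨆ t ∈ Set.Icc (0 : ℝ) κ, φ t)))
    -- the conjugate gradient polynomial `q_m` and its residual `p_m = 1 − x q_m`
    (m : ℕ) (hm : 1 ≤ m)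
    (hmγ : m ≤ ((Finset.univ.filter
      (fun j => ⟪Thalf (empRhat n Xs Ys), e' j⟫ ≠ 0)).image ξ').card)
    (q : Polynomial ℝ) (hqdeg : q.natDegree ≤ m - 1)
    -- `0 < u ≤ x_{1,m}`, the smallest root of `p_m`; `0 ≤ p_m ≤ 1` on `[0, x_{1,m})`
    (x1 : ℝ) (hx1 : IsLeast {x : ℝ | (1 - Polynomial.X * q).eval x = 0} x1)
    (hp01 : ∀ x ∈ Set.Ico (0 : ℝ) x1,
      0 ≤ (1 - Polynomial.X * q).eval x ∧ (1 - Polynomial.X * q).eval x ≤ 1)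
    (u : ℝ) (hu0 : 0 < u) (hux : u ≤ x1) :
    ‖(FuOp e' ξ' u) ((Polynomial.aeval (Thalf ∘L empCov n Xs ∘L Thalf) q)
        (Thalf (empCov n Xs βstar)) - Λα g)‖ =
      ‖(FuOp e' ξ' u) ((Polynomial.aeval (Thalf ∘L empCov n Xs ∘L Thalf)
        (1 - Polynomial.X * q)) (Λα g))‖ ∧
    ‖(FuOp e' ξ' u) ((Polynomial.aeval (Thalf ∘L empCov n Xs ∘L Thalf) q)
        (Thalf (empCov n Xs βstar)) - Λα g)‖ ≤
      2 * (u ^ α + max α 1 * (if α ≤ 1 then lam ^ α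
          else κ ^ α * Real.sqrt (M4 / (n * δ)))) * ‖g‖ := by
  set L := Thalf ∘L empCov n Xs ∘L Thalf with hL
  set p : ℝ[X] := 1 - Polynomial.X * q with hp
  set Z : ℝ := if α ≤ 1 then lam ^ α else κ ^ α * Real.sqrt (M4 / (n * δ)) with hZ
  have hZ0 : 0 ≤ max α 1 * Z := by
    have : 0 ≤ Z := by rw [hZ]; split_ifs <;> positivity
    positivity
  have hresidual : aeval L q (Thalf (empCov n Xs βstar)) - Λα g = -(aeval L p (Λα g)) := by
    have hq : aeval L p = 1 - aeval L q * L := by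
      rw [hp, mul_comm]; simp
    rw [hq, hβ]
    simp [hL]
  have hnorm : ‖FuOp e' ξ' u (aeval L q (Thalf (empCov n Xs βstar)) - Λα g)‖ =
      ‖FuOp e' ξ' u (aeval L p (Λα g))‖ := by
    rw [hresidual, map_neg, norm_neg]
  refine ⟨hnorm, hnorm.trans_le ?_⟩
  let φ : ℝ → ℝ := (Set.Ico 0 u).indicator fun t => p.eval t
  have hφ : ∀ t, 0 ≤ φ t ∧ φ t ≤ 1 := fun t => by
    by_cases ht : t ∈ Set.Ico 0 u
    · simpa only [φ, Set.indicator_of_mem ht] using hp01 t ⟨ht.1, ht.2.trans_le hux⟩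
    · simp [φ, Set.indicator_of_notMem ht]
  have hφα : ∀ t ∈ Set.Icc (0 : ℝ) κ, t ^ α * φ t ≤ u ^ α := fun t ht => by
    by_cases htu : t < u
    · exact (mul_le_of_le_one_right (Real.rpow_nonneg ht.1 α) (hφ t).2).trans
        (Real.rpow_le_rpow ht.1 htu.le hα.le)
    · have : φ t = 0 := Set.indicator_of_notMem (fun h => htu h.2) _
      rw [this, mul_zero]
      positivity
  have hφ_of_nonneg : ∀ t, 0 ≤ t → (if t < u then p.eval t else 0) = φ t := fun t ht => by
    simp [φ, Set.indicator_apply, ht]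
  have hop : FuOp e' ξ' u ∘L aeval L p = phiOp e' ξ' φ := by
    rw [aeval_eq_phiOp he' ξ' L hev' hker, FuOp_comp_phiOp he' ξ' hu0]
    exact phiOp_congr (hφ_of_nonneg 0 le_rfl) fun j => hφ_of_nonneg _ (hξ' j).1
  have hbound := hfb φ (p.continuous.measurable.indicator measurableSet_Ico)
    (fun t => (hφ t).1) ⟨1, by rintro _ ⟨t, -, rfl⟩; exact (hφ t).2⟩
  calc ‖FuOp e' ξ' u (aeval L p (Λα g))‖
      = ‖(phiOp e' ξ' φ ∘L Λα) g‖ := by rw [← hop]; rfl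
    _ ≤ ‖phiOp e' ξ' φ ∘L Λα‖ * ‖g‖ := le_opNorm _ _
    _ ≤ 2 * (u ^ α + max α 1 * Z) * ‖g‖ := by
      refine mul_le_mul_of_nonneg_right (hbound.trans ?_) (norm_nonneg g)
      refine mul_le_mul_of_nonneg_left (add_le_add ?_ ?_) zero_le_two
      · exact Real.biSup_le (by positivity) hφα
      · exact mul_le_of_le_one_right hZ0 (Real.biSup_le zero_le_one fun t _ => (hφ t).2)
end
end
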